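/- For all real μ > 0, r₀ > 0, and x with 0 < x < r₀, the absolutely convergent sum over all integers k of (r₀ - x + 2k·r₀)·exp(-μ·|r₀ - x + 2k·r₀|) equals (sinh(μx)/sinh(μr₀))·(r₀·coth(μr₀) - x·coth(μx)). -/

import Mathlib

theorem hasSum_arith_mul_exp_neg (μ a r : ℝ) (hμ : 0 < μ) (hr : 0 < r) :
    HasSum (fun n : ℕ => (a + 2 * n * r) * Real.exp (-μ * (a + 2 * n * r)))
      (Real.exp (-μ * a) * (a * (1 - Real.exp (-μ * (2 * r)))⁻¹ +
        2 * r * (Real.exp (-μ * (2 * r)) / (1 - Real.exp (-μ * (2 * r))) ^ 2))) := by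
  have hμr : 0 < μ * r := mul_pos hμ hr
  have hq : Real.exp (-μ * (2 * r)) < 1 := Real.exp_lt_one_iff.mpr (by linarith)
  have hq' : ‖Real.exp (-μ * (2 * r))‖ < 1 := by
    rwa [Real.norm_of_nonneg (Real.exp_pos _).le]
  have h := (((hasSum_geometric_of_norm_lt_one hq').mul_left a).add
    ((hasSum_coe_mul_geometric_of_norm_lt_one hq').mul_left (2 * r))).mul_left
      (Real.exp (-μ * a))
  refine h.congr_fun fun n => ?_
  have he : Real.exp (-μ * (a + 2 * n * r)) =
      Real.exp (-μ * a) * Real.exp (-μ * (2 * r)) ^ n := by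
    rw [← Real.exp_nat_mul, ← Real.exp_add]
    ring_nf
  rw [he]
  ring

theorem hasSum_int_arith_mul_exp_neg_abs (μ r₀ x : ℝ) (hμ : 0 < μ) (hx : 0 < x)
    (hxr : x < r₀) :
    HasSum (fun k : ℤ => (r₀ - x + 2 * k * r₀) * Real.exp (-μ * |r₀ - x + 2 * k * r₀|))
      ((Real.sinh (μ * x) / Real.sinh (μ * r₀)) *
        (r₀ * (Real.cosh (μ * r₀) / Real.sinh (μ * r₀)) -
         x * (Real.cosh (μ * x) / Real.sinh (μ * x)))) := by
  have hr : 0 < r₀ := hx.trans hxr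
  have h₁ := hasSum_arith_mul_exp_neg μ (r₀ - x) r₀ hμ hr
  have h₂ := (hasSum_arith_mul_exp_neg μ (r₀ + x) r₀ hμ hr).neg
  have h := HasSum.of_nat_of_neg_add_one
    (f := fun k : ℤ => (r₀ - x + 2 * k * r₀) * Real.exp (-μ * |r₀ - x + 2 * k * r₀|))
    (h₁.congr_fun fun n => by
      have : 0 ≤ r₀ - x + 2 * n * r₀ := by
        have : 0 ≤ 2 * n * r₀ := by positivity
        linarith
      simp only [Int.cast_natCast, abs_of_nonneg this])
    (h₂.congr_fun fun n => by
      have hn : 0 ≤ r₀ + x + 2 * n * r₀ := by positivity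
      have he : r₀ - x + 2 * ((-((n : ℤ) + 1) : ℤ) : ℝ) * r₀ = -(r₀ + x + 2 * n * r₀) := by
        push_cast
        ring
      simp only [he, abs_neg, abs_of_nonneg hn, neg_mul])
  convert h using 1
  have hE : 1 < Real.exp (μ * r₀) := Real.one_lt_exp_iff.mpr (mul_pos hμ hr)
  have hX : 1 < Real.exp (μ * x) := Real.one_lt_exp_iff.mpr (mul_pos hμ hx)
  have e₁ : Real.exp (-μ * (r₀ - x)) = Real.exp (μ * x) / Real.exp (μ * r₀) := by
    rw [← Real.exp_sub]
    ring_nf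
  have e₂ : Real.exp (-μ * (r₀ + x)) = (Real.exp (μ * x) * Real.exp (μ * r₀))⁻¹ := by
    rw [← Real.exp_add, ← Real.exp_neg]
    ring_nf
  have e₃ : Real.exp (-μ * (2 * r₀)) = (Real.exp (μ * r₀) ^ 2)⁻¹ := by
    rw [← Real.exp_nat_mul, ← Real.exp_neg]
    push_cast
    ring_nf
  rw [e₁, e₂, e₃, Real.sinh_eq, Real.sinh_eq, Real.cosh_eq, Real.cosh_eq, Real.exp_neg,
    Real.exp_neg]
  generalize Real.exp (μ * r₀) = E at *
  generalize Real.exp (μ * x) = X at *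
  have hE₀ : E ≠ 0 := by positivity
  have hX₀ : X ≠ 0 := by positivity
  have hE₁ : E ^ 2 - 1 ≠ 0 := by nlinarith
  have hX₁ : X ^ 2 - 1 ≠ 0 := by nlinarith
  have s₁ : E - E⁻¹ = (E ^ 2 - 1) / E := by field_simp
  have s₂ : X - X⁻¹ = (X ^ 2 - 1) / X := by field_simp
  have s₃ : 1 - (E ^ 2)⁻¹ = (E ^ 2 - 1) / E ^ 2 := by field_simp
  rw [s₁, s₂, s₃]
  field_simp
  ring


open Real

theorem stmt6 (μ r₀ x : ℝ) (hμ : 0 < μ) (hr : 0 < r₀) (hx : 0 < x) (hxr : x < r₀) :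
    Summable (fun k : ℤ => |(r₀ - x + 2 * k * r₀) * Real.exp (-μ * |r₀ - x + 2 * k * r₀|)|) ∧
    ∑' k : ℤ, (r₀ - x + 2 * k * r₀) * Real.exp (-μ * |r₀ - x + 2 * k * r₀|) =
      (Real.sinh (μ * x) / Real.sinh (μ * r₀)) *
        (r₀ * (Real.cosh (μ * r₀) / Real.sinh (μ * r₀)) -
         x * (Real.cosh (μ * x) / Real.sinh (μ * x))) := by
  have h := hasSum_int_arith_mul_exp_neg_abs μ r₀ x hμ hx hxr
  exact ⟨h.summable.abs, h.tsum_eq⟩
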